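/- arXiv:2103.01700 — 2 statements merged into one kernel-verified Lean document; each statement's English description precedes it below -/
import Mathlib

section
/- Let β ∈ [√2, 2) and δ > 0, and set ε = (δ/β)(1 + 3/β⁴) if β ≤ 1.5 and ε = (δ/β)(1 + 2/β³) if β > 1.5. Let 0 = a_0 < a_1 < ⋯ < a_m = 1 be any finite partition of [0,1] into closed intervals [a_{j-1}, a_j] (in the paper, the partition 𝒟_{N,β} generated by the points S_{I,β}(0), S_{I,β}(1), I ∈ {1,2}^N), and set t = ∑_{j=1}^m f( ½ μ_β(S_{1,β}^{-1}[a_{j-1} − ε, a_j + ε]), ½ μ_β(S_{2,β}^{-1}[a_{j-1} − ε, a_j + ε]) ). Then for every β' with β ≤ β' ≤ β + δ and β' ≤ 2, for μ_{β'}-a.e. x ∈ ℝ, liminf_{r→0⁺} log μ_{β'}(B̄(x,r)) / log r ≥ (log 2 − t) / log(β + δ). -/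
open MeasureTheory Filter Topology

/-- `m` is the infinite product on `{0,1}^ℕ` of the uniform measure on two points:
every cylinder of length `n` has mass `2⁻ⁿ`. -/
def IsCoinMeasure (m : Measure (ℕ → Fin 2)) : Prop :=
  IsProbabilityMeasure m ∧
  ∀ (n : ℕ) (w : Fin n → Fin 2),
    m {x | ∀ j : Fin n, x j.1 = w j} = (2 : ENNReal)⁻¹ ^ n

/-- The coding map `π_β(ε) = (1 - 1/β) ∑_{n≥0} ε_n β^{-n}` of the Bernoulli convolution. -/
noncomputable def piBeta (β : ℝ) (x : ℕ → Fin 2) : ℝ :=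
  (1 - 1/β) * ∑' n : ℕ, ((x n : ℕ) : ℝ) / β ^ n

/-- `φ(t) = -t log t` (with `φ(0) = 0`). -/
noncomputable def phi (t : ℝ) : ℝ := -(t * Real.log t)

/-- `f(x,y) = φ(x) + φ(y) - φ(x+y)`. -/
noncomputable def f2 (x y : ℝ) : ℝ := phi x + phi y - phi (x + y)

/-- The left shift on `{0,1}^ℕ`. -/
def shift (x : ℕ → Fin 2) : ℕ → Fin 2 := fun n => x (n + 1)

lemma measurable_shift : Measurable shift :=
  measurable_pi_lambda _ fun n => measurable_pi_apply (n + 1)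

lemma digit_nonneg (i : Fin 2) : (0 : ℝ) ≤ ((i : ℕ) : ℝ) := Nat.cast_nonneg _

lemma digit_le_one (i : Fin 2) : ((i : ℕ) : ℝ) ≤ 1 := by
  exact_mod_cast Nat.lt_succ_iff.mp i.2

lemma summable_inv_pow {b : ℝ} (hb : 1 < b) : Summable fun n : ℕ => 1 / b ^ n := by
  simpa only [one_div, inv_pow] using
    summable_geometric_of_lt_one (inv_nonneg.2 (by linarith)) (inv_lt_one_of_one_lt₀ hb)

lemma tsum_inv_pow {b : ℝ} (hb : 1 < b) : ∑' n : ℕ, 1 / b ^ n = (1 - 1 / b)⁻¹ := by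
  simp only [one_div, ← inv_pow]
  exact tsum_geometric_of_lt_one (inv_nonneg.2 (by linarith)) (inv_lt_one_of_one_lt₀ hb)

lemma digit_div_le {b : ℝ} (hb : 1 < b) (i : Fin 2) (n : ℕ) :
    ((i : ℕ) : ℝ) / b ^ n ≤ 1 / b ^ n := by
  have : 0 < b ^ n := by positivity
  gcongr
  exact digit_le_one i

lemma summable_digits {b : ℝ} (hb : 1 < b) (x : ℕ → Fin 2) :
    Summable fun n : ℕ => ((x n : ℕ) : ℝ) / b ^ n :=
  Summable.of_nonneg_of_le (fun n => by have := digit_nonneg (x n); positivity)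
    (fun n => digit_div_le hb (x n) n) (summable_inv_pow hb)

lemma piBeta_eq {b : ℝ} (hb : 1 < b) (x : ℕ → Fin 2) :
    piBeta b x = (1 - 1 / b) * ((x 0 : ℕ) : ℝ) + piBeta b (shift x) / b := by
  have hb0 : b ≠ 0 := by positivity
  unfold piBeta
  rw [(summable_digits hb x).tsum_eq_zero_add]
  have : ∀ n : ℕ, ((x (n + 1) : ℕ) : ℝ) / b ^ (n + 1) = ((shift x n : ℕ) : ℝ) / b ^ n * b⁻¹ := by
    intro n
    rw [pow_succ, ← div_div, div_eq_mul_inv _ b]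
    rfl
  simp only [this, tsum_mul_right]
  field_simp

lemma piBeta_nonneg {b : ℝ} (hb : 1 < b) (x : ℕ → Fin 2) : 0 ≤ piBeta b x := by
  have : 1 / b ≤ 1 := by rw [div_le_one (by linarith)]; linarith
  refine mul_nonneg (by linarith) (tsum_nonneg fun n => ?_)
  have := digit_nonneg (x n)
  positivity

lemma piBeta_le_one {b : ℝ} (hb : 1 < b) (x : ℕ → Fin 2) : piBeta b x ≤ 1 := by
  have h1 : 1 / b < 1 := by rw [div_lt_one (by linarith)]; linarith
  have h3 := (summable_digits hb x).tsum_le_tsum (fun n => digit_div_le hb (x n) n)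
    (summable_inv_pow hb)
  rw [tsum_inv_pow hb] at h3
  unfold piBeta
  calc _ ≤ (1 - 1 / b) * (1 - 1 / b)⁻¹ := mul_le_mul_of_nonneg_left h3 (by linarith)
    _ = 1 := mul_inv_cancel₀ (by linarith)

lemma abs_piBeta_sub_le {b : ℝ} (hb : 1 < b) (n : ℕ) (x y : ℕ → Fin 2)
    (h : ∀ k < n, x k = y k) : |piBeta b x - piBeta b y| ≤ 1 / b ^ n := by
  induction n generalizing x y with
  | zero =>
    have := piBeta_nonneg hb x
    have := piBeta_nonneg hb y
    have := piBeta_le_one hb x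
    have := piBeta_le_one hb y
    rw [pow_zero, div_one, abs_le]
    constructor <;> linarith
  | succ n ih =>
    have h1 := ih (shift x) (shift y) fun k hk => h (k + 1) (by omega)
    have hb0 : 0 < b := by linarith
    rw [piBeta_eq hb x, piBeta_eq hb y, h 0 (by omega), add_sub_add_left_eq_sub, ← sub_div,
      abs_div, abs_of_pos hb0, pow_succ, ← div_div]
    gcongr

lemma continuous_piBeta {b : ℝ} (hb : 1 < b) : Continuous (piBeta b) := by
  unfold piBeta
  refine continuous_const.mul (continuous_tsum (fun n => ?_) (summable_inv_pow hb) fun n x => ?_)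
  · exact ((continuous_of_discreteTopology (f := fun i : Fin 2 => ((i : ℕ) : ℝ))).comp
      (continuous_apply n)).div_const _
  · rw [Real.norm_of_nonneg (by have := digit_nonneg (x n); positivity)]
    exact digit_div_le hb (x n) n

lemma measurable_piBeta {b : ℝ} (hb : 1 < b) : Measurable (piBeta b) :=
  (continuous_piBeta hb).measurable

lemma piBeta_compl {b : ℝ} (hb : 1 < b) (x : ℕ → Fin 2) :
    piBeta b (fun n => 1 - x n) = 1 - piBeta b x := by
  have h1 : 1 / b < 1 := by rw [div_lt_one (by linarith)]; linarith
  have h3 : ∀ i : Fin 2, (((1 - i : Fin 2) : ℕ) : ℝ) = 1 - ((i : ℕ) : ℝ) := by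
    intro i; fin_cases i <;> simp
  unfold piBeta
  simp only [h3, sub_div]
  rw [(summable_inv_pow hb).tsum_sub (summable_digits hb x), tsum_inv_pow hb, mul_sub,
    mul_inv_cancel₀ (by linarith)]

lemma weight_le {b c : ℝ} (hb : 4 / 3 ≤ b) (hbc : b ≤ c) (n : ℕ) :
    (1 - 1 / c) / c ^ (n + 3) ≤ (1 - 1 / b) / b ^ (n + 3) := by
  have hb0 : 0 < b := by linarith
  have hc0 : 0 < c := by linarith
  have h0 : (1 - 1 / c) / c ^ 3 ≤ (1 - 1 / b) / b ^ 3 := by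
    have e1 : (1 - 1 / c) / c ^ 3 = (c - 1) / c ^ 4 := by field_simp
    have e2 : (1 - 1 / b) / b ^ 3 = (b - 1) / b ^ 4 := by field_simp
    rw [e1, e2, div_le_div_iff₀ (by positivity) (by positivity)]
    have h4 : 0 ≤ c ^ 3 * (b - 1) + c ^ 2 * b * (b - 1) + c * b ^ 2 * (b - 1) - b ^ 3 := by
      have g1 : b ^ 3 * (b - 1) ≤ c ^ 3 * (b - 1) := by gcongr; linarith
      have g2 : b ^ 2 * b * (b - 1) ≤ c ^ 2 * b * (b - 1) := by gcongr; linarith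
      have g3 : b * b ^ 2 * (b - 1) ≤ c * b ^ 2 * (b - 1) := by gcongr; linarith
      have g4 : 0 ≤ b ^ 3 * (3 * (b - 1) - 1) := mul_nonneg (by positivity) (by linarith)
      nlinarith
    nlinarith [mul_nonneg (sub_nonneg.2 hbc) h4]
  have h1 : 1 / b ≤ 1 := by rw [div_le_one (by linarith)]; linarith
  rw [add_comm, pow_add, pow_add, ← div_div, ← div_div]
  have h2 : 0 ≤ (1 - 1 / b) / b ^ 3 := div_nonneg (by linarith) (by positivity)
  exact div_le_div₀ h2 h0 (by positivity) (by gcongr)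

lemma piBeta_eq_three {b : ℝ} (hb : 1 < b) (x : ℕ → Fin 2) :
    piBeta b x = (1 - 1 / b) * ((x 0 : ℕ) : ℝ) + (1 - 1 / b) / b * ((x 1 : ℕ) : ℝ)
      + (1 - 1 / b) / b ^ 2 * ((x 2 : ℕ) : ℝ)
      + ∑' n : ℕ, (1 - 1 / b) / b ^ (n + 3) * ((x (n + 3) : ℕ) : ℝ) := by
  have hb0 : b ≠ 0 := by positivity
  have : ∀ n : ℕ, (1 - 1 / b) / b ^ (n + 3) * ((x (n + 3) : ℕ) : ℝ)
      = (1 - 1 / b) * (((x (n + 3) : ℕ) : ℝ) / b ^ (n + 3)) := by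
    intro n; field_simp
  simp only [this, tsum_mul_left]
  unfold piBeta
  rw [← (summable_digits hb x).sum_add_tsum_nat_add 3]
  simp only [Finset.sum_range_succ, Finset.sum_range_zero]
  field_simp
  ring

lemma summable_weights {b : ℝ} (hb : 1 < b) (x : ℕ → Fin 2) :
    Summable fun n : ℕ => (1 - 1 / b) / b ^ (n + 3) * ((x (n + 3) : ℕ) : ℝ) := by
  have h := ((summable_nat_add_iff 3).2 (summable_digits hb x)).mul_left (1 - 1 / b)
  refine h.congr fun n => ?_
  have hb0 : b ≠ 0 := by positivity
  field_simp

lemma piBeta_sub_le {b c : ℝ} (hb : 4 / 3 ≤ b) (hbc : b ≤ c) (hc : c ≤ 2) (x : ℕ → Fin 2) :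
    piBeta c x - piBeta b x ≤ max (1 / b ^ 2 - 1 / c ^ 2) (1 / b ^ 3 - 1 / c ^ 3) := by
  have hb0 : 0 < b := by linarith
  have hc0 : 0 < c := by linarith
  rw [piBeta_eq_three (by linarith) x, piBeta_eq_three (by linarith : 1 < b) x]
  have h1 : ∑' n : ℕ, (1 - 1 / c) / c ^ (n + 3) * ((x (n + 3) : ℕ) : ℝ)
      ≤ ∑' n : ℕ, (1 - 1 / b) / b ^ (n + 3) * ((x (n + 3) : ℕ) : ℝ) := by
    refine (summable_weights (by linarith) x).tsum_le_tsum (fun n => ?_)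
      (summable_weights (by linarith) x)
    exact mul_le_mul_of_nonneg_right (weight_le hb hbc n) (digit_nonneg _)
  set u := 1 / b with hu
  set v := 1 / c with hv
  have e1 : (1 - u) / b = u - u ^ 2 := by rw [hu]; field_simp
  have e2 : (1 - v) / c = v - v ^ 2 := by rw [hv]; field_simp
  have e3 : (1 - u) / b ^ 2 = u ^ 2 - u ^ 3 := by rw [hu]; field_simp
  have e4 : (1 - v) / c ^ 2 = v ^ 2 - v ^ 3 := by rw [hv]; field_simp
  have e5 : 1 / b ^ 2 = u ^ 2 := by rw [hu]; field_simp
  have e6 : 1 / c ^ 2 = v ^ 2 := by rw [hv]; field_simp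
  have e7 : 1 / b ^ 3 = u ^ 3 := by rw [hu]; field_simp
  have e8 : 1 / c ^ 3 = v ^ 3 := by rw [hv]; field_simp
  rw [e1, e2, e3, e4, e5, e6, e7, e8]
  have huv : v ≤ u := one_div_le_one_div_of_le hb0 hbc
  have hv2 : 1 / 2 ≤ v := one_div_le_one_div_of_le hc0 hc
  have d0 : (1 - v) * ((x 0 : ℕ) : ℝ) - (1 - u) * ((x 0 : ℕ) : ℝ) ≤ u - v := by
    nlinarith [digit_nonneg (x 0), digit_le_one (x 0)]
  have d1 : (v - v ^ 2) * ((x 1 : ℕ) : ℝ) - (u - u ^ 2) * ((x 1 : ℕ) : ℝ)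
      ≤ (v - v ^ 2) - (u - u ^ 2) := by
    have : 0 ≤ (v - v ^ 2) - (u - u ^ 2) := by nlinarith
    nlinarith [digit_nonneg (x 1), digit_le_one (x 1)]
  have d2 : (v ^ 2 - v ^ 3) * ((x 2 : ℕ) : ℝ) - (u ^ 2 - u ^ 3) * ((x 2 : ℕ) : ℝ)
      ≤ max 0 ((v ^ 2 - v ^ 3) - (u ^ 2 - u ^ 3)) := by
    have key : ∀ i : Fin 2, (v ^ 2 - v ^ 3) * ((i : ℕ) : ℝ) - (u ^ 2 - u ^ 3) * ((i : ℕ) : ℝ)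
      ≤ max 0 ((v ^ 2 - v ^ 3) - (u ^ 2 - u ^ 3)) := by
      intro i; fin_cases i <;> simp
    exact key _
  rcases max_cases 0 ((v ^ 2 - v ^ 3) - (u ^ 2 - u ^ 3)) with h | h
  · refine le_trans ?_ (le_max_left _ _)
    linarith [h.1]
  · refine le_trans ?_ (le_max_right _ _)
    linarith [h.1]

lemma abs_piBeta_sub_base_le {b c : ℝ} (hb : 4 / 3 ≤ b) (hbc : b ≤ c) (hc : c ≤ 2)
    (x : ℕ → Fin 2) :
    |piBeta c x - piBeta b x| ≤ max (1 / b ^ 2 - 1 / c ^ 2) (1 / b ^ 3 - 1 / c ^ 3) := by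
  have h1 := piBeta_sub_le hb hbc hc x
  have h2 := piBeta_sub_le hb hbc hc fun n => 1 - x n
  rw [piBeta_compl (by linarith), piBeta_compl (by linarith)] at h2
  rw [abs_le]
  constructor <;> linarith

lemma max_sub_lt_enlargement {β δ c : ℝ} (hβ : 4 / 3 ≤ β) (hδ : 0 < δ) (hc : β ≤ c)
    (hcδ : c ≤ β + δ) :
    max (1 / β ^ 2 - 1 / c ^ 2) (1 / β ^ 3 - 1 / c ^ 3) <
      if β ≤ 1.5 then (δ / β) * (1 + 3 / β ^ 4) else (δ / β) * (1 + 2 / β ^ 3) := by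
  have hb0 : 0 < β := by linarith
  have hc0 : 0 < c := by linarith
  have huv : 1 / c ≤ 1 / β := one_div_le_one_div_of_le hb0 hc
  have hd : 1 / β - 1 / c ≤ δ * (1 / β) ^ 2 := by
    have : 1 / β - 1 / c = (c - β) * ((1 / β) * (1 / c)) := by field_simp
    rw [this, sq]
    gcongr
    linarith
  have hv0 : 0 < 1 / c := by positivity
  have hu0 : 0 < 1 / β := by positivity
  have hu1 : 1 / β ≤ 3 / 4 := by rw [div_le_iff₀ hb0]; linarith
  have e5 : 1 / β ^ 2 = (1 / β) ^ 2 := by field_simp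
  have e6 : 1 / c ^ 2 = (1 / c) ^ 2 := by field_simp
  have e7 : 1 / β ^ 3 = (1 / β) ^ 3 := by field_simp
  have e8 : 1 / c ^ 3 = (1 / c) ^ 3 := by field_simp
  have e9 : (δ / β) * (1 + 3 / β ^ 4) = δ * (1 / β) * (1 + 3 * (1 / β) ^ 4) := by field_simp
  have e10 : (δ / β) * (1 + 2 / β ^ 3) = δ * (1 / β) * (1 + 2 * (1 / β) ^ 3) := by field_simp
  rw [e5, e6, e7, e8, e9, e10]
  have hu2 : ¬ β ≤ 1.5 → 1 / β ≤ 2 / 3 := by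
    intro h
    rw [div_le_iff₀ hb0]
    norm_num at h
    linarith
  generalize 1 / β = u at *
  generalize 1 / c = v at *
  have h2 : u ^ 2 - v ^ 2 ≤ δ * u * (2 * u ^ 2) := by
    calc u ^ 2 - v ^ 2 = (u - v) * (u + v) := by ring
      _ ≤ δ * u ^ 2 * (u + u) := by gcongr
      _ = _ := by ring
  have h3 : u ^ 3 - v ^ 3 ≤ δ * u * (3 * u ^ 3) := by
    calc u ^ 3 - v ^ 3 = (u - v) * (u ^ 2 + u * v + v ^ 2) := by ring
      _ ≤ δ * u ^ 2 * (u ^ 2 + u * u + u ^ 2) := by gcongr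
      _ = _ := by ring
  have hδu : 0 < δ * u := by positivity
  split_ifs with h
  · refine max_lt (h2.trans_lt ?_) (h3.trans_lt ?_) <;> refine mul_lt_mul_of_pos_left ?_ hδu
    · nlinarith [sq_nonneg (3 * u ^ 2 - 1)]
    · nlinarith [sq_nonneg (u ^ 2 - u / 2), pow_pos hu0 2, pow_pos hu0 3,
        sq_nonneg (3 * u - 2), sq_nonneg (u ^ 2 - 1 / 2)]
  · have := hu2 h
    have hp : u ^ 2 ≤ (2 / 3) ^ 2 := by gcongr
    have hp' : u ^ 3 ≤ (2 / 3) ^ 3 := by gcongr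
    have hp3 : 0 < u ^ 3 := by positivity
    refine max_lt (h2.trans_lt ?_) (h3.trans_lt ?_) <;> refine mul_lt_mul_of_pos_left ?_ hδu
    · linarith
    · linarith

lemma measurableSet_digit (n : ℕ) (i : Fin 2) : MeasurableSet {x : ℕ → Fin 2 | x n = i} :=
  (measurable_pi_apply n : Measurable fun x : ℕ → Fin 2 => x n) (measurableSet_singleton i)

/-- The set of sequences starting with the word `w`. -/
def wordCylinder (n : ℕ) (w : Fin n → Fin 2) : Set (ℕ → Fin 2) := {x | ∀ j : Fin n, x j.1 = w j}

lemma measurableSet_wordCylinder (n : ℕ) (w : Fin n → Fin 2) :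
    MeasurableSet (wordCylinder n w) := by
  unfold wordCylinder
  simp only [Set.ofPred_forall]
  exact MeasurableSet.iInter fun j => measurableSet_digit j.1 (w j)

/-- The family of all word cylinders. -/
def wordCylinders : Set (Set (ℕ → Fin 2)) := {S | ∃ n w, S = wordCylinder n w}

lemma wordCylinder_inter_eq {n k : ℕ} (hnk : n ≤ k) (w : Fin n → Fin 2) (v : Fin k → Fin 2)
    (h : (wordCylinder n w ∩ wordCylinder k v).Nonempty) :
    wordCylinder n w ∩ wordCylinder k v = wordCylinder k v := by
  obtain ⟨y, hy1, hy2⟩ := h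
  refine Set.inter_eq_right.2 fun x hx j => ?_
  have h1 := hx ⟨j.1, by omega⟩
  have h2 := hy2 ⟨j.1, by omega⟩
  have h3 := hy1 j
  simp only at h1 h2
  rw [h1, ← h2, h3]

lemma isPiSystem_wordCylinders : IsPiSystem wordCylinders := by
  rintro _ ⟨n, w, rfl⟩ _ ⟨k, v, rfl⟩ h
  rcases le_total n k with hnk | hnk
  · exact ⟨k, v, wordCylinder_inter_eq hnk w v h⟩
  · rw [Set.inter_comm] at h ⊢
    exact ⟨n, w, wordCylinder_inter_eq hnk v w h⟩

lemma generateFrom_wordCylinders :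
    (MeasurableSpace.pi : MeasurableSpace (ℕ → Fin 2)) =
      MeasurableSpace.generateFrom wordCylinders := by
  apply le_antisymm
  · refine iSup_le fun n => ?_
    rw [← measurable_iff_comap_le]
    refine @measurable_to_countable' _ _ _ _ (MeasurableSpace.generateFrom wordCylinders) _ ?_
    intro i
    have : (fun x : ℕ → Fin 2 => x n) ⁻¹' {i} =
        ⋃ w : {w : Fin (n + 1) → Fin 2 // w (Fin.last n) = i}, wordCylinder (n + 1) w.1 := by
      ext x
      simp only [Set.mem_preimage, Set.mem_singleton_iff, Set.mem_iUnion]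
      constructor
      · intro hx
        exact ⟨⟨fun j => x j.1, hx⟩, fun j => rfl⟩
      · rintro ⟨⟨w, hw⟩, hx⟩
        rw [← hw]
        exact hx (Fin.last n)
    rw [this]
    exact MeasurableSet.iUnion fun w => MeasurableSpace.measurableSet_generateFrom ⟨_, _, rfl⟩
  · refine MeasurableSpace.generateFrom_le ?_
    rintro _ ⟨n, w, rfl⟩
    exact measurableSet_wordCylinder n w

namespace IsCoinMeasure

variable {m : Measure (ℕ → Fin 2)}

lemma map_shift_restrict (hm : IsCoinMeasure m) (i : Fin 2) :
    (m.restrict {x | x 0 = i}).map shift = (2⁻¹ : ENNReal) • m := by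
  have := hm.1
  have key : ∀ (n : ℕ) (w : Fin n → Fin 2),
      (m.restrict {x | x 0 = i}).map shift (wordCylinder n w)
        = ((2⁻¹ : ENNReal) • m) (wordCylinder n w) := by
    intro n w
    rw [Measure.map_apply measurable_shift (measurableSet_wordCylinder n w),
      Measure.restrict_apply (measurable_shift (measurableSet_wordCylinder n w)),
      Measure.smul_apply]
    have : shift ⁻¹' wordCylinder n w ∩ {x | x 0 = i} =
        {x | ∀ j : Fin (n + 1), x j.1 = (Fin.cons i w : Fin (n + 1) → Fin 2) j} := by
      ext x
      simp only [Set.mem_inter_iff, Set.mem_preimage, Set.mem_ofPred_eq, Fin.forall_fin_succ,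
        Fin.cons_zero, Fin.cons_succ, wordCylinder, shift]
      exact and_comm
    rw [this, hm.2, wordCylinder, hm.2, smul_eq_mul, pow_succ']
  refine ext_of_generate_finite wordCylinders generateFrom_wordCylinders isPiSystem_wordCylinders
    ?_ ?_
  · rintro _ ⟨n, w, rfl⟩
    exact key n w
  · have : (Set.univ : Set (ℕ → Fin 2)) = wordCylinder 0 (fun j => j.elim0) := by
      ext x
      simp [wordCylinder]
    rw [this]
    exact key 0 _

lemma measure_first_inter (hm : IsCoinMeasure m) (i : Fin 2) {B : Set (ℕ → Fin 2)}
    (hB : MeasurableSet B) : m ({x | x 0 = i} ∩ shift ⁻¹' B) = 2⁻¹ * m B := by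
  have h := congrArg (fun μ => μ B) (hm.map_shift_restrict i)
  simp only [Measure.map_apply measurable_shift hB,
    Measure.restrict_apply (measurable_shift hB), Measure.smul_apply, smul_eq_mul] at h
  rw [Set.inter_comm, h]

lemma measure_eq_add (A : Set (ℕ → Fin 2)) :
    m A = m ({x | x 0 = 0} ∩ A) + m ({x | x 0 = 1} ∩ A) := by
  have hmeas : MeasurableSet {x : ℕ → Fin 2 | x 0 = 0} := measurableSet_digit 0 0
  rw [← measure_inter_add_sdiff A hmeas, Set.inter_comm]
  congr 2
  ext x
  simp only [Set.mem_sdiff, Set.mem_inter_iff, Set.mem_ofPred_eq]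
  have : ¬ x 0 = 0 ↔ x 0 = 1 := by
    generalize x 0 = i
    fin_cases i <;> simp
  tauto

lemma measurePreserving_shift (hm : IsCoinMeasure m) : MeasurePreserving shift m m := by
  refine ⟨measurable_shift, Measure.ext fun B hB => ?_⟩
  rw [Measure.map_apply measurable_shift hB, measure_eq_add, hm.measure_first_inter 0 hB,
    hm.measure_first_inter 1 hB, ← add_mul, ENNReal.inv_two_add_inv_two, one_mul]

lemma measure_inter_shift_iterate (hm : IsCoinMeasure m) (L : ℕ) {A B : Set (ℕ → Fin 2)}
    (hA : MeasurableSet A) (hB : MeasurableSet B)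
    (hdet : ∀ x y : ℕ → Fin 2, (∀ k < L, x k = y k) → (x ∈ A ↔ y ∈ A)) :
    m (A ∩ shift^[L] ⁻¹' B) = m A * m B := by
  have := hm.1
  induction L generalizing A with
  | zero =>
    rcases Set.eq_empty_or_nonempty A with rfl | ⟨x, hx⟩
    · simp
    · have : A = Set.univ := Set.eq_univ_of_forall fun y => (hdet x y (by simp)).1 hx
      simp [this]
  | succ L ih =>
    let c : Fin 2 → (ℕ → Fin 2) → (ℕ → Fin 2) := fun i z n => Nat.casesOn n i z
    have hc : ∀ i, Measurable (c i) := fun i => measurable_pi_lambda _ fun n => by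
      cases n with
      | zero => exact measurable_const
      | succ n => exact measurable_pi_apply n
    have hc' : ∀ x : ℕ → Fin 2, c (x 0) (shift x) = x := fun x => by
      funext n
      cases n <;> rfl
    have step : ∀ i, m ({x | x 0 = i} ∩ (A ∩ shift^[L + 1] ⁻¹' B))
        = m ({x | x 0 = i} ∩ A) * m B := by
      intro i
      have e1 : {x | x 0 = i} ∩ (A ∩ shift^[L + 1] ⁻¹' B) =
          {x | x 0 = i} ∩ shift ⁻¹' (c i ⁻¹' A ∩ shift^[L] ⁻¹' B) := by
        ext x
        simp only [Set.mem_inter_iff, Set.mem_ofPred_eq, Set.mem_preimage,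
          Function.iterate_succ_apply]
        refine and_congr_right fun h => ?_
        rw [← h, hc']
      have e2 : {x | x 0 = i} ∩ A = {x | x 0 = i} ∩ shift ⁻¹' (c i ⁻¹' A) := by
        ext x
        simp only [Set.mem_inter_iff, Set.mem_ofPred_eq, Set.mem_preimage]
        refine and_congr_right fun h => ?_
        rw [← h, hc']
      have hAi : MeasurableSet (c i ⁻¹' A) := hc i hA
      rw [e1, e2, hm.measure_first_inter i hAi,
        hm.measure_first_inter i (hAi.inter ((measurable_shift.iterate L) hB)), ih hAi, mul_assoc]
      intro x y hxy
      refine hdet _ _ fun k hk => ?_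
      cases k with
      | zero => rfl
      | succ k => exact hxy k (by omega)
    rw [measure_eq_add, step, step, ← add_mul, ← measure_eq_add]

lemma lintegral_first (hm : IsCoinMeasure m) (i : Fin 2) {g : (ℕ → Fin 2) → ENNReal}
    (hg : Measurable g) :
    ∫⁻ x, {x : ℕ → Fin 2 | x 0 = i}.indicator (fun x => g (shift x)) x ∂m
      = 2⁻¹ * ∫⁻ x, g x ∂m := by
  rw [lintegral_indicator (measurableSet_digit 0 i),
    ← lintegral_map hg measurable_shift, hm.map_shift_restrict i, lintegral_smul_measure,
    smul_eq_mul]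

/-- Strong law of large numbers along the shift, for functions of finitely many coordinates. -/
lemma ae_tendsto_average (hm : IsCoinMeasure m) {L : ℕ} {g : (ℕ → Fin 2) → ℝ}
    (hg : Measurable g) (hint : Integrable g m)
    (hdet : ∀ x y : ℕ → Fin 2, (∀ k < L, x k = y k) → g x = g y) :
    ∀ᵐ x ∂m, Tendsto (fun N : ℕ => (∑ k ∈ Finset.range (L * N), g (shift^[k] x)) / N)
      atTop (𝓝 (L * ∫ x, g x ∂m)) := by
  have := hm.1
  have hpres : ∀ k, MeasurePreserving shift^[k] m m := hm.measurePreserving_shift.iterate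
  have slln : ∀ r : ℕ, ∀ᵐ x ∂m, Tendsto (fun N : ℕ =>
      (∑ q ∈ Finset.range N, g (shift^[L * q + r] x)) / N) atTop (𝓝 (∫ x, g x ∂m)) := by
    intro r
    have hid : ∀ k, ProbabilityTheory.IdentDistrib (fun x => g (shift^[k] x)) g m m := fun k =>
      ⟨(hg.comp (hpres k).measurable).aemeasurable, hg.aemeasurable, by
        have : (fun x => g (shift^[k] x)) = g ∘ shift^[k] := rfl
        rw [this, ← Measure.map_map hg (hpres k).measurable, (hpres k).map_eq]⟩
    have hlt : ∀ q q' : ℕ, q < q' → ProbabilityTheory.IndepFun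
        (fun x => g (shift^[L * q + r] x)) (fun x => g (shift^[L * q' + r] x)) m := by
      intro q q' hqq
      rw [ProbabilityTheory.indepFun_iff_measure_inter_preimage_eq_mul]
      intro S T hS hT
      obtain ⟨d, rfl⟩ := Nat.exists_eq_add_of_lt hqq
      have e1 : (fun x => g (shift^[L * q + r] x)) ⁻¹' S = shift^[L * q + r] ⁻¹' (g ⁻¹' S) := rfl
      have e2 : (fun x => g (shift^[L * (q + d + 1) + r] x)) ⁻¹' T =
          shift^[L * q + r] ⁻¹' (shift^[L] ⁻¹' (shift^[L * d] ⁻¹' (g ⁻¹' T))) := by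
        ext x
        simp only [Set.mem_preimage, ← Function.iterate_add_apply]
        rw [show L * d + (L + (L * q + r)) = L * (q + d + 1) + r by ring]
      have hT' : MeasurableSet (shift^[L * d] ⁻¹' (g ⁻¹' T)) := (hpres _).measurable (hg hT)
      rw [e1, e2, ← Set.preimage_inter,
        (hpres _).measure_preimage
          (((hg hS).inter ((hpres L).measurable hT')).nullMeasurableSet),
        (hpres _).measure_preimage (hg hS).nullMeasurableSet,
        (hpres _).measure_preimage ((hpres L).measurable hT').nullMeasurableSet,
        (hpres _).measure_preimage hT'.nullMeasurableSet]
      refine hm.measure_inter_shift_iterate L (hg hS) hT' fun x y hxy => ?_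
      rw [Set.mem_preimage, Set.mem_preimage, hdet x y hxy]
    have h := ProbabilityTheory.strong_law_ae_real (μ := m)
      (fun q x => g (shift^[L * q + r] x))
      ((hid _).integrable_iff.2 hint) (fun q q' hqq => by
        rcases lt_or_gt_of_ne hqq with h | h
        · exact hlt _ _ h
        · exact (hlt _ _ h).symm)
      (fun q => (hid _).trans (hid _).symm)
    have hE : ∫ x, g (shift^[L * 0 + r] x) ∂m = ∫ x, g x ∂m := (hid _).integral_eq
    rw [hE] at h
    exact h
  have hall := ae_all_iff.2 slln
  filter_upwards [hall] with x hx
  have h1 := tendsto_finsetSum (Finset.range L) fun r _ => hx r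
  simp only [Finset.sum_const, Finset.card_range, nsmul_eq_mul] at h1
  refine h1.congr fun N => ?_
  rw [← Finset.sum_div, Finset.sum_comm]
  congr 1
  induction N with
  | zero => simp
  | succ N ih => rw [Finset.sum_range_succ, ih, Nat.mul_succ, Finset.sum_range_add]

end IsCoinMeasure

/-- The probability that a random walk on the line, which at `y` picks the digit `i` with
probability `W i y` and moves to `b * y - i * (b - 1)`, reads the first `n` digits of `x`
when it starts at `y`. -/
noncomputable def walkWeight (b : ℝ) (W : Fin 2 → ℝ → ENNReal) :
    ℕ → ℝ → (ℕ → Fin 2) → ENNReal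
  | 0, _, _ => 1
  | n + 1, y, x => ∑ i : Fin 2, {x : ℕ → Fin 2 | x 0 = i}.indicator
      (fun x => W i y * walkWeight b W n (b * y - ((i : ℕ) : ℝ) * (b - 1)) (shift x)) x

lemma walkWeight_succ (b : ℝ) (W : Fin 2 → ℝ → ENNReal) (n : ℕ) (y : ℝ) (x : ℕ → Fin 2) :
    walkWeight b W (n + 1) y x =
      W (x 0) y * walkWeight b W n (b * y - ((x 0 : ℕ) : ℝ) * (b - 1)) (shift x) := by
  rw [walkWeight, Finset.sum_eq_single (x 0)]
  · simp
  · intro i _ hi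
    rw [Set.indicator_of_notMem]
    exact fun h => hi h.symm
  · simp

lemma measurable_walkWeight (b : ℝ) (W : Fin 2 → ℝ → ENNReal) (n : ℕ) (y : ℝ) :
    Measurable (walkWeight b W n y) := by
  induction n generalizing y with
  | zero => exact measurable_const
  | succ n ih =>
    have : walkWeight b W (n + 1) y = fun x => ∑ i : Fin 2, {x : ℕ → Fin 2 | x 0 = i}.indicator
        (fun x => W i y * walkWeight b W n (b * y - ((i : ℕ) : ℝ) * (b - 1)) (shift x)) x := by
      funext x
      rw [walkWeight]
    rw [this]
    exact Finset.measurable_fun_sum _ fun i _ =>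
      (((ih _).comp measurable_shift).const_mul _).indicator (measurableSet_digit 0 i)

lemma lintegral_walkWeight {m : Measure (ℕ → Fin 2)} (hm : IsCoinMeasure m) (b : ℝ)
    {W : Fin 2 → ℝ → ENNReal} (hW : ∀ y, W 0 y + W 1 y = 1) (n : ℕ) (y : ℝ) :
    ∫⁻ x, walkWeight b W n y x ∂m = 2⁻¹ ^ n := by
  have := hm.1
  induction n generalizing y with
  | zero => simp [walkWeight]
  | succ n ih =>
    have hmeas : ∀ i : Fin 2, Measurable fun x : ℕ → Fin 2 =>
        W i y * walkWeight b W n (b * y - ((i : ℕ) : ℝ) * (b - 1)) x := fun i =>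
      (measurable_walkWeight b W n _).const_mul _
    have hind : ∀ i : Fin 2, Measurable fun x => {x : ℕ → Fin 2 | x 0 = i}.indicator
        (fun x => W i y * walkWeight b W n (b * y - ((i : ℕ) : ℝ) * (b - 1)) (shift x)) x :=
      fun i => ((hmeas i).comp measurable_shift).indicator (measurableSet_digit 0 i)
    simp only [walkWeight]
    rw [lintegral_finsetSum _ fun i _ => hind i]
    have : ∀ i : Fin 2, ∫⁻ x, {x : ℕ → Fin 2 | x 0 = i}.indicator
        (fun x => W i y * walkWeight b W n (b * y - ((i : ℕ) : ℝ) * (b - 1)) (shift x)) x ∂m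
        = W i y * 2⁻¹ ^ (n + 1) := by
      intro i
      rw [hm.lintegral_first i (hmeas i),
        lintegral_const_mul _ (measurable_walkWeight b W n _), ih, pow_succ]
      ring
    simp only [this, Fin.sum_univ_two]
    rw [← add_mul, hW, one_mul]

lemma exp_neg_sum_le_walkWeight {b κ : ℝ} (hb : 1 < b) (hκ : 0 ≤ κ) {w : Fin 2 → ℝ → ℝ}
    (hw : ∀ i y, 0 < w i y) {g : (ℕ → Fin 2) → ℝ}
    (hg : ∀ x y, |piBeta b x - y| ≤ κ → -Real.log (w (x 0) y) ≤ g x)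
    (n : ℕ) (x : ℕ → Fin 2) (y : ℝ) (hxy : |piBeta b x - y| ≤ κ / b ^ n) :
    ENNReal.ofReal (Real.exp (-∑ k ∈ Finset.range n, g (shift^[k] x))) ≤
      walkWeight b (fun i y => ENNReal.ofReal (w i y)) n y x := by
  have hb0 : 0 < b := by linarith
  induction n generalizing x y with
  | zero => simp [walkWeight]
  | succ n ih =>
    have h1 : |piBeta b x - y| ≤ κ :=
      hxy.trans (div_le_self hκ (one_le_pow₀ hb.le))
    have h2 : |piBeta b (shift x) - (b * y - ((x 0 : ℕ) : ℝ) * (b - 1))| ≤ κ / b ^ n := by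
      have e : piBeta b (shift x) - (b * y - ((x 0 : ℕ) : ℝ) * (b - 1)) =
          b * (piBeta b x - y) := by
        rw [piBeta_eq hb x]
        field_simp
        ring
      rw [e, abs_mul, abs_of_pos hb0]
      calc b * |piBeta b x - y| ≤ b * (κ / b ^ (n + 1)) := by gcongr
        _ = κ / b ^ n := by rw [pow_succ]; field_simp
    rw [walkWeight_succ, Finset.sum_range_succ', neg_add_rev, Real.exp_add,
      ENNReal.ofReal_mul (Real.exp_nonneg _)]
    gcongr
    · rw [← Real.exp_log (hw (x 0) y)]
      apply Real.exp_le_exp.2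
      have := hg x y h1
      simp only [Function.iterate_zero, id]
      linarith
    · exact ih (shift x) _ h2

lemma measure_inter_preimage_closedBall_le {m : Measure (ℕ → Fin 2)} (hm : IsCoinMeasure m)
    {b κ : ℝ} (hb : 1 < b) (hκ : 0 ≤ κ) {w : Fin 2 → ℝ → ℝ}
    (hw : ∀ i y, 0 < w i y) (hw1 : ∀ y, w 0 y + w 1 y = 1) {g : (ℕ → Fin 2) → ℝ}
    (hg : ∀ x y, |piBeta b x - y| ≤ κ → -Real.log (w (x 0) y) ≤ g x)
    (n : ℕ) (τ : ℝ) {A : Set (ℕ → Fin 2)}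
    (hA : ∀ x ∈ A, ∑ k ∈ Finset.range n, g (shift^[k] x) ≤ n * τ) (y : ℝ) :
    m (A ∩ piBeta b ⁻¹' Metric.closedBall y (κ / b ^ n)) ≤
      ENNReal.ofReal (Real.exp (-(n * (Real.log 2 - τ)))) := by
  set W : Fin 2 → ℝ → ENNReal := fun i y => ENNReal.ofReal (w i y) with hWdef
  have hW : ∀ y, W 0 y + W 1 y = 1 := fun y => by
    rw [hWdef]
    simp only
    rw [← ENNReal.ofReal_add (hw 0 y).le (hw 1 y).le, hw1, ENNReal.ofReal_one]
  set e := ENNReal.ofReal (Real.exp (-(n * τ))) with he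
  have he0 : e ≠ 0 := by
    rw [he, ne_eq, ENNReal.ofReal_eq_zero, not_le]
    exact Real.exp_pos _
  have h1 : m (A ∩ piBeta b ⁻¹' Metric.closedBall y (κ / b ^ n)) ≤
      m {x | e ≤ walkWeight b W n y x} := by
    refine measure_mono fun x hx => ?_
    refine le_trans ?_ (exp_neg_sum_le_walkWeight hb hκ hw hg n x y ?_)
    · exact ENNReal.ofReal_le_ofReal (Real.exp_le_exp.2 (neg_le_neg (hA x hx.1)))
    · have := hx.2
      rwa [Set.mem_preimage, Metric.mem_closedBall, Real.dist_eq] at this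
  have h2 := mul_meas_ge_le_lintegral (μ := m) (measurable_walkWeight b W n y) e
  rw [lintegral_walkWeight hm b hW] at h2
  have h3 : ENNReal.ofReal (Real.exp (-(n * (Real.log 2 - τ)))) = 2⁻¹ ^ n / e := by
    rw [he, ← ENNReal.ofReal_ofNat 2, ← ENNReal.ofReal_inv_of_pos (by norm_num),
      ← ENNReal.ofReal_pow (by norm_num), ← ENNReal.ofReal_div_of_pos (Real.exp_pos _)]
    congr 1
    rw [← Real.exp_log (show (0 : ℝ) < 2⁻¹ by norm_num), ← Real.exp_nat_mul, ← Real.exp_sub,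
      Real.log_inv]
    congr 1
    ring
  rw [h3, ENNReal.le_div_iff_mul_le (Or.inl he0) (Or.inl ENNReal.ofReal_ne_top), mul_comm]
  exact (mul_le_mul_right h1 e).trans h2

/-- A measure whose balls decay along a geometric sequence of radii forces the same lower local
dimension on every larger measure, almost everywhere. -/
lemma ae_le_log_measure_div_log {ν μ : Measure ℝ} [IsFiniteMeasure μ] (hνμ : ν ≤ μ)
    {b κ σ : ℝ} (hb : 1 < b) (hκ : 0 < κ) (hσ : 0 ≤ σ) {L : ℕ} (hL : 0 < L) (N₀ : ℕ)
    (h : ∀ y, ∀ N ≥ N₀, ν (Metric.closedBall y (κ / b ^ (L * N))) ≤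
      ENNReal.ofReal (Real.exp (-((L * N : ℕ) * σ)))) :
    ∀ᵐ y ∂ν, ∀ θ < σ / Real.log b, ∀ᶠ r in 𝓝[>] (0 : ℝ),
      θ ≤ Real.log (μ (Metric.closedBall y r)).toReal / Real.log r := by
  have : IsFiniteMeasure ν := isFiniteMeasure_of_le μ hνμ
  have hac : ν ≪ μ := Measure.absolutelyContinuous_of_le hνμ
  have hlb : 0 < Real.log b := Real.log_pos hb
  have hL' : (0 : ℝ) < L := by exact_mod_cast hL
  filter_upwards [hac.ae_le (Besicovitch.ae_tendsto_rnDeriv ν μ), Measure.rnDeriv_pos hac]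
    with y hy hpos θ hθ
  obtain ⟨c, hc0, hc⟩ := exists_between hpos
  have hctop : c ≠ ⊤ := (hc.trans_le le_top).ne
  have hcpos : 0 < c.toReal := ENNReal.toReal_pos hc0.ne' hctop
  set s := σ / Real.log b with hs
  set C := -s * Real.log κ + L * σ - Real.log c.toReal with hC
  have hlog : Tendsto (fun r : ℝ => -Real.log r) (𝓝[>] 0) atTop :=
    tendsto_neg_atBot_atTop.comp Real.tendsto_log_nhdsGT_zero
  filter_upwards [hy.eventually (lt_mem_nhds hc), hlog.eventually_gt_atTop 0,
    hlog.eventually_ge_atTop (C / (s - θ)),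
    hlog.eventually_ge_atTop (N₀ * (L * Real.log b) - Real.log κ), self_mem_nhdsWithin]
    with r hr1 hr2 hr3 hr4 hr0
  have hr0 : 0 < r := hr0
  set B := Metric.closedBall y r with hB
  have hBpos : μ B ≠ 0 := by
    intro h0
    have : ν B = 0 := hac h0
    simp [this] at hr1
  have hBtop : μ B ≠ ⊤ := measure_ne_top _ _
  set q := (Real.log κ - Real.log r) / (L * Real.log b) with hq
  set N := ⌊q⌋₊ with hN
  have hN0 : N₀ ≤ N := by
    apply Nat.le_floor
    rw [hq, le_div_iff₀ (by positivity)]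
    linarith
  have hq0 : 0 ≤ q := by
    refine le_trans (Nat.cast_nonneg N₀) ?_
    rw [hq, le_div_iff₀ (by positivity)]
    linarith
  have hNq : (N : ℝ) ≤ q := Nat.floor_le hq0
  have hqN : q < N + 1 := Nat.lt_floor_add_one q
  have hNq' : (L * N : ℝ) * Real.log b ≤ Real.log κ - Real.log r := by
    rw [hq, le_div_iff₀ (by positivity)] at hNq
    linarith
  have hqN' : Real.log κ - Real.log r < (L * N + L : ℝ) * Real.log b := by
    rw [hq, div_lt_iff₀ (by positivity)] at hqN
    linarith
  have hrad : r ≤ κ / b ^ (L * N) := by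
    have hb' : 0 < b ^ (L * N) := by positivity
    rw [← Real.log_le_log_iff hr0 (by positivity), Real.log_div hκ.ne' hb'.ne', Real.log_pow]
    push_cast
    linarith
  have hmain : c * μ B ≤ ENNReal.ofReal (Real.exp (-((L * N : ℕ) * σ))) :=
    (ENNReal.mul_le_of_le_div hr1.le).trans
      ((measure_mono (Metric.closedBall_subset_closedBall hrad)).trans (h y N hN0))
  have hreal : c.toReal * (μ B).toReal ≤ Real.exp (-((L * N : ℕ) * σ)) := by
    rw [← ENNReal.toReal_mul]
    exact ENNReal.toReal_le_of_le_ofReal (Real.exp_nonneg _) hmain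
  have hμpos : 0 < (μ B).toReal := ENNReal.toReal_pos hBpos hBtop
  have hlogm : Real.log c.toReal + Real.log (μ B).toReal ≤ -((L * N : ℝ) * σ) := by
    rw [← Real.log_mul hcpos.ne' hμpos.ne']
    have := Real.log_le_log (by positivity) hreal
    rw [Real.log_exp] at this
    push_cast at this
    exact this
  have hσs : σ = s * Real.log b := by rw [hs]; field_simp
  have hs0 : 0 ≤ s := div_nonneg hσ hlb.le
  rw [le_div_iff_of_neg (by linarith)]
  have h5 : s * (Real.log κ - Real.log r) ≤ s * ((L * N + L : ℝ) * Real.log b) := by gcongr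
  have h6 : s * ((L * N + L : ℝ) * Real.log b) = (L * N : ℝ) * σ + L * σ := by rw [hσs]; ring
  rw [div_le_iff₀ (by linarith)] at hr3
  nlinarith

lemma frequently_log_measure_div_log_le {m : Measure (ℕ → Fin 2)} (hm : IsCoinMeasure m)
    {b : ℝ} (hb : 1 < b) (x : ℕ → Fin 2) :
    ∃ᶠ r in 𝓝[>] (0 : ℝ),
      Real.log ((m.map (piBeta b)) (Metric.closedBall (piBeta b x) r)).toReal / Real.log r
        ≤ Real.log 2 / Real.log b := by
  have := hm.1
  have : IsProbabilityMeasure (m.map (piBeta b)) :=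
    Measure.isProbabilityMeasure_map (measurable_piBeta hb).aemeasurable
  have hb0 : 0 < b := by linarith
  have hlb : 0 < Real.log b := Real.log_pos hb
  have ht : Tendsto (fun n : ℕ => 1 / b ^ n) atTop (𝓝[>] 0) := by
    refine tendsto_nhdsWithin_iff.2 ⟨?_, Eventually.of_forall fun n => ?_⟩
    · simpa only [one_div, inv_pow] using
        tendsto_pow_atTop_nhds_zero_of_lt_one (inv_nonneg.2 hb0.le) (inv_lt_one_of_one_lt₀ hb)
    · exact one_div_pos.2 (pow_pos hb0 n)
  refine ht.frequently (Eventually.frequently ?_)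
  filter_upwards [eventually_gt_atTop 0] with n hn
  have hn' : (0 : ℝ) < n := by exact_mod_cast hn
  have hle : (2 : ENNReal)⁻¹ ^ n ≤
      (m.map (piBeta b)) (Metric.closedBall (piBeta b x) (1 / b ^ n)) := by
    rw [Measure.map_apply (measurable_piBeta hb) Metric.isClosed_closedBall.measurableSet,
      ← hm.2 n fun j => x j]
    refine measure_mono fun z hz => ?_
    rw [Set.mem_preimage, Metric.mem_closedBall, Real.dist_eq]
    exact abs_piBeta_sub_le hb n z x fun k hk => hz ⟨k, hk⟩
  have hle' := ENNReal.toReal_mono (measure_ne_top _ _) hle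
  rw [ENNReal.toReal_pow, ENNReal.toReal_inv, ENNReal.toReal_ofNat] at hle'
  have hlog := Real.log_le_log (by positivity) hle'
  rw [Real.log_pow, Real.log_inv] at hlog
  rw [one_div (b ^ n), Real.log_inv, Real.log_pow, ← neg_div_neg_eq, neg_neg,
    div_le_div_iff₀ (by positivity) hlb]
  rw [one_div] at hlog
  nlinarith

lemma continuous_phi : Continuous phi := by
  have : phi = Real.negMulLog := by
    funext x
    simp [phi, Real.negMulLog]
  rw [this]
  exact Real.continuous_negMulLog

lemma f2_eq {x y : ℝ} (hx : 0 < x) (hy : 0 < y) :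
    f2 x y = x * -Real.log (x / (x + y)) + y * -Real.log (y / (x + y)) := by
  rw [Real.log_div hx.ne' (by positivity), Real.log_div hy.ne' (by positivity)]
  unfold f2 phi
  ring

lemma exists_mem_Icc_of_mesh (a : ℕ → ℝ) {M : ℕ} (hM : 1 ≤ M) {z : ℝ} (h0 : a 0 ≤ z)
    (h1 : z ≤ a M) : ∃ j < M, z ∈ Set.Icc (a j) (a (j + 1)) := by
  induction M, hM using Nat.le_induction with
  | base => exact ⟨0, by omega, h0, h1⟩
  | succ M hM ih =>
    rcases le_total z (a M) with h | h
    · obtain ⟨j, hj, hz⟩ := ih h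
      exact ⟨j, by omega, hz⟩
    · exact ⟨M, by omega, h, h1⟩

/-- The sequence obtained from `x` by replacing all digits from the `L`-th on by `0`. -/
def truncateAt (L : ℕ) (x : ℕ → Fin 2) : ℕ → Fin 2 := fun n => if n < L then x n else 0

lemma measurable_truncateAt (L : ℕ) : Measurable (truncateAt L) :=
  measurable_pi_lambda _ fun n => by
    by_cases h : n < L
    · simpa only [truncateAt, h, if_true] using measurable_pi_apply n
    · simp only [truncateAt, h, if_false, measurable_const]

lemma abs_piBeta_truncateAt_sub_le {b : ℝ} (hb : 1 < b) (L : ℕ) (x : ℕ → Fin 2) :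
    |piBeta b (truncateAt L x) - piBeta b x| ≤ 1 / b ^ L :=
  abs_piBeta_sub_le hb L _ _ fun k hk => by simp [truncateAt, hk]

/-- If `p i j` dominates the probability that the first digit is `i` and that the point lies in
a neighbourhood of the `j`-th interval of a partition of `[0, 1]`, then the partition entropy of
`p` bounds the lower local dimension from below. -/
lemma ae_le_log_measure_div_log_of_partition {m : Measure (ℕ → Fin 2)} (hm : IsCoinMeasure m)
    {b κ : ℝ} (hb : 1 < b) (hκ : 0 < κ) {M : ℕ} (hM : 1 ≤ M) {a : ℕ → ℝ}
    (ha0 : a 0 = 0) (haM : a M = 1) {p : Fin 2 → ℕ → ℝ}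
    (hp : ∀ i, ∀ j < M,
      m.real {x | x 0 = i ∧ piBeta b x ∈ Set.Icc (a j - 3 * κ) (a (j + 1) + 3 * κ)} ≤ p i j)
    {τ : ℝ} (hτ : ∑ j ∈ Finset.range M, f2 (p 0 j) (p 1 j) < τ) (hτ2 : τ ≤ Real.log 2) :
    ∀ᵐ y ∂(m.map (piBeta b)), ∀ θ < (Real.log 2 - τ) / Real.log b, ∀ᶠ r in 𝓝[>] (0 : ℝ),
      θ ≤ Real.log ((m.map (piBeta b)) (Metric.closedBall y r)).toReal / Real.log r := by
  have := hm.1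
  have hb0 : 0 < b := by linarith
  obtain ⟨s, hs, hs0⟩ : ∃ s : ℝ,
      ∑ j ∈ Finset.range M, f2 (p 0 j + s) (p 1 j + s) < τ ∧ 0 < s := by
    have hcont : Continuous fun s : ℝ => ∑ j ∈ Finset.range M, f2 (p 0 j + s) (p 1 j + s) := by
      unfold f2
      refine continuous_finsetSum _ fun j _ => ?_
      refine ((continuous_phi.comp ?_).add (continuous_phi.comp ?_)).sub (continuous_phi.comp ?_)
        <;> fun_prop
    have h0 : ∀ᶠ s in 𝓝 (0 : ℝ),
        ∑ j ∈ Finset.range M, f2 (p 0 j + s) (p 1 j + s) < τ :=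
      hcont.continuousAt.eventually_lt_const (by simpa using hτ)
    exact ((h0.filter_mono nhdsWithin_le_nhds).and
      (self_mem_nhdsWithin : Set.Ioi (0 : ℝ) ∈ 𝓝[>] 0)).exists
  obtain ⟨L, hL, hL0⟩ : ∃ L : ℕ, 1 / b ^ L ≤ κ ∧ 0 < L := by
    have ht : Tendsto (fun n : ℕ => 1 / b ^ n) atTop (𝓝 0) := by
      simpa only [one_div, inv_pow] using
        tendsto_pow_atTop_nhds_zero_of_lt_one (inv_nonneg.2 hb0.le) (inv_lt_one_of_one_lt₀ hb)
    exact ((ht.eventually_le_const hκ).and (eventually_gt_atTop 0)).exists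
  have hp0 : ∀ i, ∀ j < M, 0 < p i j + s := fun i j hj => by
    have := measureReal_nonneg.trans (hp i j hj)
    linarith
  set ρ : Fin 2 → ℕ → ℝ := fun i j => (p i j + s) / ((p 0 j + s) + (p 1 j + s)) with hρ
  have hρ0 : ∀ i, ∀ j < M, 0 < ρ i j := fun i j hj =>
    div_pos (hp0 i j hj) (add_pos (hp0 0 j hj) (hp0 1 j hj))
  have hρsum : ∀ j < M, ρ 0 j + ρ 1 j = 1 := fun j hj => by
    rw [hρ]
    simp only
    rw [← add_div, div_self (add_pos (hp0 0 j hj) (hp0 1 j hj)).ne']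
  have hρ1 : ∀ i, ∀ j < M, 0 ≤ -Real.log (ρ i j) := fun i j hj => by
    have h0 := hρ0 0 j hj
    have h1 := hρ0 1 j hj
    have h2 := hρsum j hj
    rw [neg_nonneg]
    refine Real.log_nonpos (hρ0 i j hj).le ?_
    fin_cases i <;> simp only [Fin.zero_eta, Fin.mk_one] <;> linarith
  have hcell : ∀ y : ℝ, ∃ j < M, ∀ z ∈ Set.Icc (0 : ℝ) 1, ∀ d, |z - y| ≤ d →
      z ∈ Set.Icc (a j - d) (a (j + 1) + d) := by
    intro y
    obtain ⟨j, hj, hj1, hj2⟩ := exists_mem_Icc_of_mesh a hM (z := max 0 (min y 1))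
      (by rw [ha0]; exact le_max_left _ _)
      (by rw [haM]; exact max_le zero_le_one (min_le_right _ _))
    refine ⟨j, hj, fun z hz d hd => ?_⟩
    have h2 : |z - max 0 (min y 1)| ≤ |z - y| := by
      obtain ⟨hz0, hz1⟩ := hz
      rcases max_cases 0 (min y 1) with h | h <;> rcases min_cases y 1 with h' | h' <;>
        rw [abs_le] <;> constructor <;>
        cases abs_cases (z - y) <;> linarith
    have h3 := abs_le.1 (h2.trans hd)
    constructor <;> linarith [h3.1, h3.2]
  choose cell hcellM hcell using hcell
  set E : Fin 2 → ℕ → Set (ℕ → Fin 2) := fun i j => {x | x 0 = i} ∩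
    (fun x => piBeta b (truncateAt L x)) ⁻¹' Set.Icc (a j - 2 * κ) (a (j + 1) + 2 * κ) with hE
  have hEmeas : ∀ i j, MeasurableSet (E i j) := fun i j =>
    (measurableSet_digit 0 i).inter
      (((measurable_piBeta hb).comp (measurable_truncateAt L)) measurableSet_Icc)
  have hEp : ∀ i, ∀ j < M, m.real (E i j) ≤ p i j + s := by
    intro i j hj
    refine (measureReal_mono ?_).trans ((hp i j hj).trans (by linarith))
    rintro x ⟨hx0, hx1, hx2⟩
    have h := abs_le.1 ((abs_piBeta_truncateAt_sub_le hb L x).trans hL)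
    exact ⟨hx0, by linarith [h.1, h.2], by linarith [h.1, h.2]⟩
  set g : (ℕ → Fin 2) → ℝ := fun x => ∑ j ∈ Finset.range M, ∑ i : Fin 2,
    (E i j).indicator (fun _ => -Real.log (ρ i j)) x with hg
  have hterm : ∀ i j, Integrable ((E i j).indicator fun _ => -Real.log (ρ i j)) m := fun i j =>
    (integrable_const _).indicator (hEmeas i j)
  have hgmeas : Measurable g := Finset.measurable_fun_sum _ fun j _ =>
    Finset.measurable_fun_sum _ fun i _ => measurable_const.indicator (hEmeas i j)
  have hgint : Integrable g m :=
    integrable_finsetSum _ fun j _ => integrable_finsetSum _ fun i _ => hterm i j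
  have hgE : ∫ x, g x ∂m < τ := by
    refine lt_of_le_of_lt ?_ hs
    rw [hg, integral_finsetSum _ fun j _ => integrable_finsetSum _ fun i _ => hterm i j]
    refine Finset.sum_le_sum fun j hj => ?_
    have hj := Finset.mem_range.1 hj
    rw [integral_finsetSum _ fun i _ => hterm i j, Fin.sum_univ_two,
      f2_eq (hp0 0 j hj) (hp0 1 j hj)]
    have hi : ∀ i, ∫ x, (E i j).indicator (fun _ => -Real.log (ρ i j)) x ∂m ≤
        (p i j + s) * -Real.log (ρ i j) := fun i => by
      rw [integral_indicator_const _ (hEmeas i j), smul_eq_mul]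
      exact mul_le_mul_of_nonneg_right (hEp i j hj) (hρ1 i j hj)
    exact add_le_add (hi 0) (hi 1)
  have hgdet : ∀ x y : ℕ → Fin 2, (∀ k < L, x k = y k) → g x = g y := by
    intro x y hxy
    have h1 : truncateAt L x = truncateAt L y := by
      funext n
      by_cases h : n < L
      · simp [truncateAt, h, hxy n h]
      · simp [truncateAt, h]
    have h2 : ∀ i j, (x ∈ E i j ↔ y ∈ E i j) := fun i j => by
      simp only [hE, Set.mem_inter_iff, Set.mem_ofPred_eq, Set.mem_preimage, h1, hxy 0 hL0]
    refine Finset.sum_congr rfl fun j _ => Finset.sum_congr rfl fun i _ => ?_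
    by_cases h : x ∈ E i j
    · rw [Set.indicator_of_mem h, Set.indicator_of_mem ((h2 i j).1 h)]
    · rw [Set.indicator_of_notMem h, Set.indicator_of_notMem fun h' => h ((h2 i j).2 h')]
  have hgw : ∀ x y, |piBeta b x - y| ≤ κ → -Real.log (ρ (x 0) (cell y)) ≤ g x := by
    intro x y hxy
    have hmem : x ∈ E (x 0) (cell y) := by
      refine ⟨rfl, hcell y _ ⟨piBeta_nonneg hb _, piBeta_le_one hb _⟩ _ ?_⟩
      have h := (abs_piBeta_truncateAt_sub_le hb L x).trans hL
      calc |piBeta b (truncateAt L x) - y|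
          ≤ |piBeta b (truncateAt L x) - piBeta b x| + |piBeta b x - y| := abs_sub_le _ _ _
        _ ≤ 2 * κ := by linarith
    have hnn : ∀ j ∈ Finset.range M, ∀ i : Fin 2,
        0 ≤ (E i j).indicator (fun _ => -Real.log (ρ i j)) x := fun j hj i =>
      Set.indicator_nonneg (fun _ _ => hρ1 i j (Finset.mem_range.1 hj)) x
    calc -Real.log (ρ (x 0) (cell y))
        = (E (x 0) (cell y)).indicator (fun _ => -Real.log (ρ (x 0) (cell y))) x := by
          rw [Set.indicator_of_mem hmem]
      _ ≤ ∑ i : Fin 2, (E i (cell y)).indicator (fun _ => -Real.log (ρ i (cell y))) x :=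
          Finset.single_le_sum
            (f := fun i => (E i (cell y)).indicator (fun _ => -Real.log (ρ i (cell y))) x)
            (fun i _ => hnn _ (Finset.mem_range.2 (hcellM y)) i) (Finset.mem_univ _)
      _ ≤ g x := Finset.single_le_sum
            (f := fun j => ∑ i : Fin 2, (E i j).indicator (fun _ => -Real.log (ρ i j)) x)
            (fun j hj => Finset.sum_nonneg fun i _ => hnn j hj i)
            (Finset.mem_range.2 (hcellM y))
  set A : ℕ → Set (ℕ → Fin 2) := fun N₀ => {x | ∀ N ≥ N₀,
    ∑ k ∈ Finset.range (L * N), g (shift^[k] x) ≤ (L * N : ℕ) * τ} with hA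
  have hAae : ∀ᵐ x ∂m, x ∈ ⋃ N₀, A N₀ := by
    filter_upwards [hm.ae_tendsto_average hgmeas hgint hgdet] with x hx
    have hL' : (0 : ℝ) < L := by exact_mod_cast hL0
    have h1 := hx.eventually_lt_const (mul_lt_mul_of_pos_left hgE hL')
    obtain ⟨N₀, hN₀⟩ := eventually_atTop.1 (h1.and (eventually_gt_atTop 0))
    refine Set.mem_iUnion.2 ⟨N₀, fun N hN => ?_⟩
    obtain ⟨h2, h3⟩ := hN₀ N hN
    have h3' : (0 : ℝ) < N := by exact_mod_cast h3
    rw [div_lt_iff₀ h3'] at h2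
    push_cast
    linarith
  have hle : m.map (piBeta b) ≤ Measure.sum fun N₀ => (m.restrict (A N₀)).map (piBeta b) := by
    have h1 : m ≤ Measure.sum fun N₀ => m.restrict (A N₀) := by
      calc m = m.restrict (⋃ N₀, A N₀) := (Measure.restrict_eq_self_of_ae_mem hAae).symm
        _ ≤ _ := Measure.restrict_iUnion_le
    refine Measure.le_iff.2 fun S hS => ?_
    rw [Measure.map_apply (measurable_piBeta hb) hS, Measure.sum_apply _ hS]
    refine (h1 _).trans (le_of_eq ?_)
    rw [Measure.sum_apply _ (measurable_piBeta hb hS)]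
    exact tsum_congr fun N₀ => (Measure.map_apply (measurable_piBeta hb) hS).symm
  refine (Measure.absolutelyContinuous_of_le hle).ae_le ?_
  refine Measure.ae_sum_iff.2 fun N₀ => ?_
  have : IsFiniteMeasure (m.map (piBeta b)) := Measure.isFiniteMeasure_map m _
  refine ae_le_log_measure_div_log (Measure.map_mono Measure.restrict_le_self
    (measurable_piBeta hb)) hb hκ (sub_nonneg.2 hτ2) hL0 N₀ fun y N hN => ?_
  rw [Measure.map_apply (measurable_piBeta hb) Metric.isClosed_closedBall.measurableSet,
    Measure.restrict_apply
      (measurable_piBeta hb Metric.isClosed_closedBall.measurableSet), Set.inter_comm]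
  exact measure_inter_preimage_closedBall_le hm hb hκ.le (w := fun i y => ρ i (cell y))
    (fun i y => hρ0 i _ (hcellM y)) (fun y => hρsum _ (hcellM y)) hgw (L * N) τ
    (A := A N₀) (fun x hx => hx N hN) y

lemma IsCoinMeasure.half_mul_map_preimage {m : Measure (ℕ → Fin 2)} (hm : IsCoinMeasure m)
    {b : ℝ} (hb : 1 < b) (i : Fin 2) {F : ℝ → ℝ} (hF : Measurable F)
    (hF' : ∀ y, F y = (1 - 1 / b) * ((i : ℕ) : ℝ) + y / b) {J : Set ℝ} (hJ : MeasurableSet J) :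
    (1 / 2) * ((m.map (piBeta b)) (F ⁻¹' J)).toReal =
      m.real {x | x 0 = i ∧ piBeta b x ∈ J} := by
  have h : {x : ℕ → Fin 2 | x 0 = i ∧ piBeta b x ∈ J} =
      {x | x 0 = i} ∩ shift ⁻¹' (piBeta b ⁻¹' (F ⁻¹' J)) := by
    ext x
    simp only [Set.mem_inter_iff, Set.mem_ofPred_eq, Set.mem_preimage]
    refine and_congr_right fun hx => ?_
    rw [hF', piBeta_eq hb x, hx]
  rw [h, measureReal_def, hm.measure_first_inter i (measurable_piBeta hb (hF hJ)),
    ENNReal.toReal_mul, Measure.map_apply (measurable_piBeta hb) (hF hJ), ENNReal.toReal_inv,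
    ENNReal.toReal_ofNat, one_div]

theorem stmt10 (β δ : ℝ) (hβ1 : Real.sqrt 2 ≤ β) (hβ2 : β < 2) (hδ : 0 < δ)
    (ε : ℝ)
    (hε : ε = if β ≤ 1.5 then (δ / β) * (1 + 3 / β ^ 4) else (δ / β) * (1 + 2 / β ^ 3))
    (M : ℕ) (hM : 1 ≤ M) (a : ℕ → ℝ)
    (ha0 : a 0 = 0) (haM : a M = 1) (hinc : ∀ j < M, a j < a (j + 1))
    (m : Measure (ℕ → Fin 2)) (hm : IsCoinMeasure m)
    (t : ℝ)
    (ht : t = ∑ j ∈ Finset.range M,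
      f2 ((1 / 2) * ((m.map (piBeta β))
            ((fun x : ℝ => x / β) ⁻¹' Set.Icc (a j - ε) (a (j + 1) + ε))).toReal)
        ((1 / 2) * ((m.map (piBeta β))
            ((fun x : ℝ => x / β + 1 - 1 / β) ⁻¹' Set.Icc (a j - ε) (a (j + 1) + ε))).toReal)) :
    ∀ β' : ℝ, β ≤ β' → β' ≤ β + δ → β' ≤ 2 →
      ∀ᵐ x ∂(m.map (piBeta β')),
        (Real.log 2 - t) / Real.log (β + δ) ≤
          liminf (fun r : ℝ =>
            Real.log (((m.map (piBeta β')) (Metric.closedBall x r)).toReal) / Real.log r)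
            (𝓝[>] 0) := by
  intro b hb hbδ hb2
  have := hm.1
  have hβ43 : 4 / 3 ≤ β := le_trans (Real.le_sqrt_of_sq_le (by norm_num)) hβ1
  have hβ : 1 < β := by linarith
  have hb1 : 1 < b := by linarith
  have hprob : IsProbabilityMeasure (m.map (piBeta b)) :=
    Measure.isProbabilityMeasure_map (measurable_piBeta hb1).aemeasurable
  have hlb : 0 < Real.log b := Real.log_pos hb1
  have hlle : Real.log b ≤ Real.log (β + δ) := Real.log_le_log (by linarith) hbδ
  have hrange : ∀ᵐ y ∂(m.map (piBeta b)), y ∈ Set.range (piBeta b) :=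
    ae_map_mem_range _ (isCompact_range (continuous_piBeta hb1)).measurableSet m
  set p : Fin 2 → ℕ → ℝ := fun i j =>
    m.real {x | x 0 = i ∧ piBeta β x ∈ Set.Icc (a j - ε) (a (j + 1) + ε)} with hp
  have htp : t = ∑ j ∈ Finset.range M, f2 (p 0 j) (p 1 j) := by
    rw [ht]
    refine Finset.sum_congr rfl fun j _ => ?_
    rw [hm.half_mul_map_preimage hβ 0 (by fun_prop) (fun y => by simp) measurableSet_Icc,
      hm.half_mul_map_preimage hβ 1 (by fun_prop) (fun y => by simp; ring) measurableSet_Icc]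
  obtain ⟨κ, hκ, hκε⟩ : ∃ κ > 0, ∀ x, |piBeta b x - piBeta β x| + 3 * κ ≤ ε := by
    have h := max_sub_lt_enlargement hβ43 hδ hb hbδ
    rw [← hε] at h
    refine ⟨(ε - max (1 / β ^ 2 - 1 / b ^ 2) (1 / β ^ 3 - 1 / b ^ 3)) / 3, by linarith,
      fun x => ?_⟩
    linarith [abs_piBeta_sub_base_le hβ43 hb hb2 x]
  have hsub : ∀ i, ∀ j < M,
      m.real {x | x 0 = i ∧ piBeta b x ∈ Set.Icc (a j - 3 * κ) (a (j + 1) + 3 * κ)} ≤ p i j := by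
    intro i j _
    refine measureReal_mono ?_
    rintro x ⟨hx0, hx1, hx2⟩
    have h1 := hκε x
    have h2 := neg_abs_le (piBeta b x - piBeta β x)
    have h3 := le_abs_self (piBeta b x - piBeta β x)
    exact ⟨hx0, by linarith, by linarith⟩
  have hpos : ∀ᵐ y ∂(m.map (piBeta b)), t < Real.log 2 → ∀ k : ℕ,
      ∀ θ < (Real.log 2 - (t + (Real.log 2 - t) * (1 / ((k : ℝ) + 1)))) / Real.log b,
      ∀ᶠ r in 𝓝[>] (0 : ℝ),
        θ ≤ Real.log ((m.map (piBeta b)) (Metric.closedBall y r)).toReal / Real.log r := by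
    by_cases htl : t < Real.log 2
    · simp only [htl, true_imp_iff]
      rw [ae_all_iff]
      intro k
      have hk : 0 < 1 / ((k : ℝ) + 1) := by positivity
      have hk1 : 1 / ((k : ℝ) + 1) ≤ 1 := by
        rw [div_le_one (by positivity)]
        linarith [(Nat.cast_nonneg k : (0 : ℝ) ≤ k)]
      refine ae_le_log_measure_div_log_of_partition hm hb1 hκ hM ha0 haM hsub ?_ ?_
      · rw [← htp]
        nlinarith
      · nlinarith
    · exact Eventually.of_forall fun y h => absurd h htl
  filter_upwards [hrange, hpos] with y ⟨x, hx⟩ hy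
  have hcob : (𝓝[>] (0 : ℝ)).IsCoboundedUnder (· ≥ ·) (fun r : ℝ =>
      Real.log (((m.map (piBeta b)) (Metric.closedBall y r)).toReal) / Real.log r) := by
    rw [← hx]
    exact IsCoboundedUnder.of_frequently_le (frequently_log_measure_div_log_le hm hb1 x)
  refine le_of_forall_lt_imp_le_of_dense fun θ hθ => ?_
  refine le_liminf_of_le hcob ?_
  rcases le_or_gt θ 0 with hθ0 | hθ0
  · have h1 : ∀ᶠ r in 𝓝[>] (0 : ℝ), r < 1 :=
      (eventually_lt_nhds zero_lt_one).filter_mono nhdsWithin_le_nhds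
    filter_upwards [h1, self_mem_nhdsWithin] with r hr1 hr0
    refine hθ0.trans (div_nonneg_of_nonpos ?_ (Real.log_nonpos (le_of_lt hr0) hr1.le))
    exact Real.log_nonpos ENNReal.toReal_nonneg
      (ENNReal.toReal_le_of_le_ofReal zero_le_one (by simpa using prob_le_one))
  · have htl : t < Real.log 2 := by
      have h := (div_pos_iff_of_pos_right (hlb.trans_le hlle)).1 (hθ0.trans hθ)
      linarith
    have hθb : θ < (Real.log 2 - t) / Real.log b := by
      refine hθ.trans_le ?_
      have : 0 ≤ Real.log 2 - t := by linarith
      gcongr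
    have hlim : Tendsto (fun k : ℕ =>
        (Real.log 2 - (t + (Real.log 2 - t) * (1 / ((k : ℝ) + 1)))) / Real.log b) atTop
        (𝓝 ((Real.log 2 - (t + (Real.log 2 - t) * 0)) / Real.log b)) :=
      ((tendsto_const_nhds.sub (tendsto_const_nhds.add
        (tendsto_const_nhds.mul tendsto_one_div_add_atTop_nhds_zero_nat))).div_const _)
    rw [mul_zero, add_zero] at hlim
    obtain ⟨k, hk⟩ := (hlim.eventually_const_lt hθb).exists
    exact hy htl k θ hk
end

section
/- Let √2 ≤ β < β' ≤ 2 and set ξ = 2β^{-3} if β > 1.5 and ξ = 3β^{-4} if β ≤ 1.5. Then for all real numbers c < d: μ_{β'}([c, d]) ≤ μ_β([c − ξ(β' − β), d + ξ(β' − β)]). -/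
open MeasureTheory Filter Topology

/-- If a sequence with sum zero is nonnegative before `k` and nonpositive from `k` on, every sum
with weights in `[0, 1]` is bounded by the sum of the nonnegative part. -/
lemma abs_tsum_weighted_le {D e : ℕ → ℝ} (k : ℕ) (hD : HasSum D 0)
    (he0 : ∀ n, 0 ≤ e n) (he1 : ∀ n, e n ≤ 1)
    (hpos : ∀ n < k, 0 ≤ D n) (hneg : ∀ n, k ≤ n → D n ≤ 0) :
    |∑' n, e n * D n| ≤ ∑ n ∈ Finset.range k, D n := by
  have hs : Summable fun n => e n * D n := by
    refine Summable.of_norm_bounded hD.summable.norm fun n => ?_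
    rw [norm_mul]
    refine mul_le_of_le_one_left (norm_nonneg _) ?_
    rw [Real.norm_of_nonneg (he0 n)]
    exact he1 n
  have hsplit := hs.sum_add_tsum_nat_add k
  have hsplitD := hD.summable.sum_add_tsum_nat_add k
  rw [hD.tsum_eq] at hsplitD
  have htail : ∑' n, D (n + k) ≤ ∑' n, e (n + k) * D (n + k) := by
    refine Summable.tsum_le_tsum (fun n => ?_) ((summable_nat_add_iff k).2 hD.summable)
      ((summable_nat_add_iff k).2 hs)
    nlinarith [he1 (n + k), hneg (n + k) (by omega)]
  have htail0 : ∑' n, e (n + k) * D (n + k) ≤ 0 :=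
    tsum_nonpos fun n =>
      mul_nonpos_of_nonneg_of_nonpos (he0 _) (hneg (n + k) (by omega))
  have hhead0 : 0 ≤ ∑ n ∈ Finset.range k, e n * D n :=
    Finset.sum_nonneg fun n hn => mul_nonneg (he0 n) (hpos n (Finset.mem_range.1 hn))
  have hhead : ∑ n ∈ Finset.range k, e n * D n ≤ ∑ n ∈ Finset.range k, D n :=
    Finset.sum_le_sum fun n hn =>
      mul_le_of_le_one_left (hpos n (Finset.mem_range.1 hn)) (he1 n)
  rw [abs_le]
  constructor <;> linarith

lemma digit_nonneg_s14 (x : ℕ → Fin 2) (n : ℕ) : (0 : ℝ) ≤ ((x n : ℕ) : ℝ) := Nat.cast_nonneg _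

lemma digit_le_one_s14 (x : ℕ → Fin 2) (n : ℕ) : ((x n : ℕ) : ℝ) ≤ 1 := by
  exact_mod_cast Nat.le_of_lt_succ (x n).2

lemma hasSum_geometric_mul_one_sub {a : ℝ} (h0 : 0 ≤ a) (h1 : a < 1) :
    HasSum (fun n : ℕ => a ^ n * (1 - a)) 1 := by
  have h := (hasSum_geometric_of_lt_one h0 h1).mul_right (1 - a)
  rwa [inv_mul_cancel₀ (by linarith)] at h

lemma summable_digit_mul {a : ℝ} (h0 : 0 ≤ a) (h1 : a < 1) (x : ℕ → Fin 2) :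
    Summable fun n : ℕ => ((x n : ℕ) : ℝ) * (a ^ n * (1 - a)) := by
  have hnn : ∀ n : ℕ, 0 ≤ a ^ n * (1 - a) := fun n =>
    mul_nonneg (pow_nonneg h0 n) (by linarith)
  exact Summable.of_nonneg_of_le (fun n => mul_nonneg (digit_nonneg_s14 x n) (hnn n))
    (fun n => mul_le_of_le_one_left (hnn n) (digit_le_one_s14 x n))
    (hasSum_geometric_mul_one_sub h0 h1).summable

lemma piBeta_eq_tsum (β : ℝ) (x : ℕ → Fin 2) :
    piBeta β x = ∑' n : ℕ, ((x n : ℕ) : ℝ) * (β⁻¹ ^ n * (1 - β⁻¹)) := by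
  rw [piBeta, ← tsum_mul_left]
  refine tsum_congr fun n => ?_
  rw [inv_pow, one_div, div_eq_mul_inv]
  ring

lemma measurable_piBeta_s14 {β : ℝ} (hβ : 1 < β) : Measurable (piBeta β) := by
  have h0 : 0 ≤ β⁻¹ := by positivity
  have h1 : β⁻¹ < 1 := inv_lt_one_of_one_lt₀ hβ
  refine measurable_of_tendsto_metrizable
    (f := fun (N : ℕ) (x : ℕ → Fin 2) =>
      ∑ n ∈ Finset.range N, ((x n : ℕ) : ℝ) * (β⁻¹ ^ n * (1 - β⁻¹))) (fun N => ?_) ?_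
  · refine Finset.measurable_sum _ fun n _ => Measurable.mul_const ?_ _
    exact (measurable_of_countable fun i : Fin 2 => ((i : ℕ) : ℝ)).comp (measurable_pi_apply n)
  · rw [tendsto_pi_nhds]
    intro x
    rw [piBeta_eq_tsum]
    exact (summable_digit_mul h0 h1 x).hasSum.tendsto_sum_nat

/-- If passing from `β` to `β'` raises the first `k` digit weights and lowers the others, the
values of the coding maps differ by at most the change `β⁻ᵏ - β'⁻ᵏ` of the tail weight. -/
lemma abs_piBeta_sub_le_s14 {β β' : ℝ} (hβ : 1 < β) (hβ' : 1 < β') (k : ℕ)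
    (hpos : ∀ n < k, β⁻¹ ^ n * (1 - β⁻¹) ≤ β'⁻¹ ^ n * (1 - β'⁻¹))
    (hneg : ∀ n, k ≤ n → β'⁻¹ ^ n * (1 - β'⁻¹) ≤ β⁻¹ ^ n * (1 - β⁻¹)) (x : ℕ → Fin 2) :
    |piBeta β' x - piBeta β x| ≤ β⁻¹ ^ k - β'⁻¹ ^ k := by
  have h0 : 0 ≤ β⁻¹ := by positivity
  have h1 : β⁻¹ < 1 := inv_lt_one_of_one_lt₀ hβ
  have h0' : 0 ≤ β'⁻¹ := by positivity
  have h1' : β'⁻¹ < 1 := inv_lt_one_of_one_lt₀ hβ'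
  have hD : HasSum (fun n : ℕ => β'⁻¹ ^ n * (1 - β'⁻¹) - β⁻¹ ^ n * (1 - β⁻¹)) 0 := by
    simpa using (hasSum_geometric_mul_one_sub h0' h1').sub (hasSum_geometric_mul_one_sub h0 h1)
  have h := abs_tsum_weighted_le k hD (digit_nonneg_s14 x) (digit_le_one_s14 x)
    (fun n hn => sub_nonneg.2 (hpos n hn)) (fun n hn => sub_nonpos.2 (hneg n hn))
  rw [piBeta_eq_tsum, piBeta_eq_tsum,
    ← (summable_digit_mul h0' h1' x).tsum_sub (summable_digit_mul h0 h1 x)]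
  simp only [← mul_sub]
  refine h.trans_eq ?_
  rw [Finset.sum_sub_distrib, ← Finset.sum_mul, ← Finset.sum_mul, geom_sum_mul_neg,
    geom_sum_mul_neg]
  ring

lemma pow_mul_one_sub_le_of_le {a b : ℝ} (hb : 0 ≤ b) (hab : b ≤ a) (ha : a ≤ 1) {k n : ℕ}
    (hkn : k ≤ n) (h : b ^ k * (1 - b) ≤ a ^ k * (1 - a)) :
    b ^ n * (1 - b) ≤ a ^ n * (1 - a) := by
  induction n, hkn using Nat.le_induction with
  | base => exact h
  | succ n _ ih =>
    have hnn : 0 ≤ b ^ n * (1 - b) := mul_nonneg (pow_nonneg hb n) (by linarith)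
    calc b ^ (n + 1) * (1 - b) = b * (b ^ n * (1 - b)) := by ring
      _ ≤ a * (a ^ n * (1 - a)) := mul_le_mul hab ih hnn (hb.trans hab)
      _ = a ^ (n + 1) * (1 - a) := by ring

lemma inv_pow_sub_inv_pow_le {β β' : ℝ} (hβ : 0 < β) (h : β ≤ β') (k : ℕ) :
    β⁻¹ ^ k - β'⁻¹ ^ k ≤ k / β ^ (k + 1) * (β' - β) := by
  have hβ' : 0 < β' := hβ.trans_le h
  have hbern := one_add_mul_le_pow (a := β / β' - 1) (by
    have : 0 ≤ β / β' := by positivity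
    linarith) k
  have hratio : 1 - β / β' ≤ (β' - β) / β := by
    rw [one_sub_div hβ'.ne']
    exact div_le_div_of_nonneg_left (by linarith) hβ h
  have hk : 1 - (β / β') ^ k ≤ k * ((β' - β) / β) := by
    rw [add_sub_cancel] at hbern
    nlinarith [mul_le_mul_of_nonneg_left hratio (Nat.cast_nonneg (α := ℝ) k)]
  calc β⁻¹ ^ k - β'⁻¹ ^ k = β⁻¹ ^ k * (1 - (β / β') ^ k) := by
        rw [div_pow, inv_pow, inv_pow]
        field_simp
    _ ≤ β⁻¹ ^ k * (k * ((β' - β) / β)) := by gcongr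
    _ = k / β ^ (k + 1) * (β' - β) := by
        rw [inv_pow]
        field_simp
        ring

lemma abs_piBeta_sub_le_of_le_three_halves {β β' : ℝ} (h1 : √2 ≤ β) (h2 : β ≤ β')
    (h3 : β' ≤ 3 / 2) (x : ℕ → Fin 2) :
    |piBeta β' x - piBeta β x| ≤ 3 / β ^ 4 * (β' - β) := by
  have hβ : 4 / 3 < β := lt_of_lt_of_le (Real.lt_sqrt_of_sq_lt (by norm_num)) h1
  have ha : β⁻¹ ≤ 3 / 4 := by
    rw [inv_le_comm₀ (by linarith) (by norm_num)]
    linarith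
  have hb : 2 / 3 ≤ β'⁻¹ := by
    rw [le_inv_comm₀ (by norm_num) (by linarith)]
    linarith
  have hba : β'⁻¹ ≤ β⁻¹ := inv_anti₀ (by linarith) h2
  have h := abs_piBeta_sub_le_s14 (β := β) (β' := β') (by linarith) (by linarith) 3
    (fun n hn => ?_) (fun n hn => ?_) x
  · exact h.trans (by simpa using inv_pow_sub_inv_pow_le (by linarith) h2 3)
  · generalize β⁻¹ = a at *
    generalize β'⁻¹ = b at *
    interval_cases n
    · linarith
    · nlinarith
    · have hq : 0 ≤ (a ^ 2 + a * b + b ^ 2) - (a + b) := by nlinarith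
      nlinarith [mul_nonneg (sub_nonneg.2 hba) hq]
  · refine pow_mul_one_sub_le_of_le (by linarith) hba (by linarith) hn ?_
    generalize β⁻¹ = a at *
    generalize β'⁻¹ = b at *
    have hq : 0 ≤ (a ^ 2 + a * b + b ^ 2) - (a + b) * (a ^ 2 + b ^ 2) := by
      nlinarith [mul_nonneg (sub_nonneg.2 ha) (sq_nonneg a),
        mul_nonneg (sub_nonneg.2 ha) (sq_nonneg b),
        mul_nonneg (sub_nonneg.2 (hba.trans ha)) (sq_nonneg a),
        mul_nonneg (sub_nonneg.2 (hba.trans ha)) (sq_nonneg b), sq_nonneg (a - b)]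
    nlinarith [mul_nonneg (sub_nonneg.2 hba) hq]

lemma abs_piBeta_sub_le_of_three_halves_le {β β' : ℝ} (h1 : 3 / 2 ≤ β) (h2 : β ≤ β')
    (h3 : β' ≤ 2) (x : ℕ → Fin 2) :
    |piBeta β' x - piBeta β x| ≤ 2 / β ^ 3 * (β' - β) := by
  have ha : β⁻¹ ≤ 2 / 3 := by
    rw [inv_le_comm₀ (by linarith) (by norm_num)]
    linarith
  have hb : 1 / 2 ≤ β'⁻¹ := by
    rw [le_inv_comm₀ (by norm_num) (by linarith)]
    linarith
  have hba : β'⁻¹ ≤ β⁻¹ := inv_anti₀ (by linarith) h2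
  have h := abs_piBeta_sub_le_s14 (β := β) (β' := β') (by linarith) (by linarith) 2
    (fun n hn => ?_) (fun n hn => ?_) x
  · exact h.trans (by simpa using inv_pow_sub_inv_pow_le (by linarith) h2 2)
  · generalize β⁻¹ = a at *
    generalize β'⁻¹ = b at *
    interval_cases n
    · linarith
    · nlinarith
  · refine pow_mul_one_sub_le_of_le (by linarith) hba (by linarith) hn ?_
    generalize β⁻¹ = a at *
    generalize β'⁻¹ = b at *
    have hq : 0 ≤ (a + b) - (a ^ 2 + a * b + b ^ 2) := by
      nlinarith
    nlinarith [mul_nonneg (sub_nonneg.2 hba) hq]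

lemma abs_piBeta_sub_le_mul {β β' : ℝ} (h1 : √2 ≤ β) (h2 : β < β') (h3 : β' ≤ 2)
    (x : ℕ → Fin 2) :
    |piBeta β' x - piBeta β x| ≤ (if β ≤ 1.5 then 3 / β ^ 4 else 2 / β ^ 3) * (β' - β) := by
  have hβ : 0 < β := lt_of_lt_of_le (by positivity) h1
  split_ifs with hc
  · have hc : β ≤ 3 / 2 := by norm_num at hc ⊢; exact hc
    rcases le_total β' (3 / 2) with h | h
    · exact abs_piBeta_sub_le_of_le_three_halves h1 h2.le h x
    · have hlow := abs_piBeta_sub_le_of_le_three_halves h1 hc le_rfl x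
      have hhigh := abs_piBeta_sub_le_of_three_halves_le le_rfl h h3 x
      have hξ : 2 / (3 / 2 : ℝ) ^ 3 ≤ 3 / β ^ 4 := by
        calc 2 / (3 / 2 : ℝ) ^ 3 = 3 / (3 / 2) ^ 4 := by norm_num
          _ ≤ 3 / β ^ 4 := by gcongr
      have hmul := mul_le_mul_of_nonneg_right hξ (sub_nonneg.2 h)
      have htri := abs_sub_le (piBeta β' x) (piBeta (3 / 2) x) (piBeta β x)
      linarith
  · have hc : 3 / 2 ≤ β := by norm_num at hc ⊢; exact hc.le
    exact abs_piBeta_sub_le_of_three_halves_le hc h2.le h3 x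

theorem stmt14 (β β' : ℝ) (h1 : Real.sqrt 2 ≤ β) (h2 : β < β') (h3 : β' ≤ 2)
    (ξ : ℝ) (hξ : ξ = if β ≤ 1.5 then 3 / β ^ 4 else 2 / β ^ 3)
    (m : Measure (ℕ → Fin 2)) (hm : IsCoinMeasure m) :
    ∀ c d : ℝ, c < d →
      (m.map (piBeta β')) (Set.Icc c d) ≤
        (m.map (piBeta β)) (Set.Icc (c - ξ * (β' - β)) (d + ξ * (β' - β))) := by
  intro c d _
  have hβ : 1 < β := lt_of_lt_of_le (Real.lt_sqrt_of_sq_lt (by norm_num)) h1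
  rw [Measure.map_apply (measurable_piBeta_s14 (hβ.trans h2)) measurableSet_Icc,
    Measure.map_apply (measurable_piBeta_s14 hβ) measurableSet_Icc]
  refine measure_mono fun x hx => ?_
  have h := abs_le.1 (abs_piBeta_sub_le_mul h1 h2 h3 x)
  rw [← hξ] at h
  rw [Set.mem_preimage, Set.mem_Icc] at hx ⊢
  constructor <;> linarith [h.1, h.2, hx.1, hx.2]
end
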